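/- arXiv:2512.11209 — 2 statements merged into one kernel-verified Lean document; each statement's English description precedes it below -/
import Mathlib

section
/- For every probability distribution P over bit functions and every free operation μ, writing Q = Γ_μ(P), one has (Q(I) + Q(F)) · (1 − |P(R0) − P(R1)|) ≤ (P(I) + P(F)) · (1 − |Q(R0) − Q(R1)|). (This is the cross-multiplied form of the statement that the quantity M_{|γ|,β}(P) = (P(I)+P(F)) / (1 − |P(R0)−P(R1)|) is non-increasing under free operations.) -/
open Finset

/-- `P` is a probability distribution over the four bit functions. -/
def IsDist (P : (Bool → Bool) → ℝ) : Prop :=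
  (∀ f, 0 ≤ P f) ∧ ∑ f : Bool → Bool, P f = 1

/-- `μ` is a probability distribution over pairs (pre-processing, post-processing),
specifying a free operation. -/
def IsFreeOp (μ : ((Bool → Bool) × (Bool → Bool)) → ℝ) : Prop :=
  (∀ gh, 0 ≤ μ gh) ∧ ∑ gh : (Bool → Bool) × (Bool → Bool), μ gh = 1

/-- The action `Γ_μ` of a free operation `μ` on a distribution `P` over bit functions:
`Γ_μ(P)(f') = ∑_{(g,h)} μ(g,h) · ∑_{f : h ∘ f ∘ g = f'} P(f)`. -/
noncomputable def Gamma (μ : ((Bool → Bool) × (Bool → Bool)) → ℝ)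
    (P : (Bool → Bool) → ℝ) : (Bool → Bool) → ℝ :=
  fun f' => ∑ gh : (Bool → Bool) × (Bool → Bool),
    μ gh * ∑ f : Bool → Bool, if gh.2 ∘ f ∘ gh.1 = f' then P f else 0

/-- The identity bit function `I`. -/
def bitI : Bool → Bool := id
/-- The flip bit function `F`. -/
def bitF : Bool → Bool := fun b => !b
/-- The reset-to-zero bit function `R0`. -/
def bitR0 : Bool → Bool := fun _ => false
/-- The reset-to-one bit function `R1`. -/
def bitR1 : Bool → Bool := fun _ => true

theorem sum_bit (f : (Bool → Bool) → ℝ) :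
    ∑ x, f x = f bitI + f bitF + f bitR0 + f bitR1 := by
  have h : (Finset.univ : Finset (Bool → Bool)) = {bitI, bitF, bitR0, bitR1} := by decide
  rw [h, Finset.sum_insert (by decide), Finset.sum_insert (by decide),
    Finset.sum_insert (by decide), Finset.sum_singleton]
  ring

theorem bit_cases : ∀ g : Bool → Bool, g = bitI ∨ g = bitF ∨ g = bitR0 ∨ g = bitR1 := by
  decide

/-- The action of a single pair `(g, h)`. -/
noncomputable def single (P : (Bool → Bool) → ℝ) (gh : (Bool → Bool) × (Bool → Bool))
    (f' : Bool → Bool) : ℝ :=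
  ∑ f : Bool → Bool, if gh.2 ∘ f ∘ gh.1 = f' then P f else 0

theorem comp_bitI (f : Bool → Bool) : f ∘ bitI = f := rfl
theorem bitI_comp (f : Bool → Bool) : bitI ∘ f = f := rfl
theorem bitR0_comp (f : Bool → Bool) : bitR0 ∘ f = bitR0 := rfl
theorem bitR1_comp (f : Bool → Bool) : bitR1 ∘ f = bitR1 := rfl
theorem FF : bitF ∘ bitF = bitI := by decide
theorem FR0 : bitF ∘ bitR0 = bitR1 := by decide
theorem FR1 : bitF ∘ bitR1 = bitR0 := by decide
theorem nIF : bitI ≠ bitF := by decide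
theorem nI0 : bitI ≠ bitR0 := by decide
theorem nI1 : bitI ≠ bitR1 := by decide
theorem nF0 : bitF ≠ bitR0 := by decide
theorem nF1 : bitF ≠ bitR1 := by decide
theorem n01 : bitR0 ≠ bitR1 := by decide

theorem single_bound (P : (Bool → Bool) → ℝ) (hP : IsDist P)
    (gh : (Bool → Bool) × (Bool → Bool)) :
    (single P gh bitI + single P gh bitF) * (1 - |P bitR0 - P bitR1|)
      ≤ (P bitI + P bitF) * (1 - |single P gh bitR0 - single P gh bitR1|) := by
  obtain ⟨h0, h1⟩ := hP
  rw [sum_bit] at h1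
  have a := h0 bitI
  have b := h0 bitF
  have c := h0 bitR0
  have d := h0 bitR1
  obtain ⟨g, h⟩ := gh
  rcases bit_cases g with rfl | rfl | rfl | rfl <;>
  rcases bit_cases h with rfl | rfl | rfl | rfl <;>
  simp only [single, sum_bit, comp_bitI, bitI_comp, bitR0_comp, bitR1_comp, FF, FR0, FR1,
    nIF, nI0, nI1, nF0, nF1, n01, nIF.symm, nI0.symm, nI1.symm, nF0.symm, nF1.symm, n01.symm,
    if_true, if_false, add_zero, zero_add, zero_mul,
    show bitR0 ∘ bitF = bitR0 from rfl, show bitR1 ∘ bitF = bitR1 from rfl] <;>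
  first
  | (apply le_of_eq; ring1)
  | (rw [abs_sub_comm (P bitR0)]; done)
  | (rw [abs_sub_comm (P bitR0)]; apply le_of_eq; ring1)
  | (refine mul_nonneg (by linarith) (sub_nonneg.2 (abs_le.2 ⟨?_, ?_⟩)) <;> linarith)

/-- cross-multiplied form of the monotonicity of
`M_{|γ|,β}(P) = (P(I)+P(F)) / (1 − |P(R0)−P(R1)|)` under free operations. -/
theorem stmt_4 (P : (Bool → Bool) → ℝ) (hP : IsDist P)
    (μ : ((Bool → Bool) × (Bool → Bool)) → ℝ) (hμ : IsFreeOp μ)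
    (Q : (Bool → Bool) → ℝ) (hQ : Q = Gamma μ P) :
    (Q bitI + Q bitF) * (1 - |P bitR0 - P bitR1|)
      ≤ (P bitI + P bitF) * (1 - |Q bitR0 - Q bitR1|) := by
  have hc : 0 ≤ P bitI + P bitF := add_nonneg (hP.1 _) (hP.1 _)
  have hG : ∀ f, Q f = ∑ gh, μ gh * single P gh f := fun f => by rw [hQ]; rfl
  have habs : |Q bitR0 - Q bitR1| ≤
      ∑ gh, μ gh * |single P gh bitR0 - single P gh bitR1| := by
    rw [hG, hG, ← Finset.sum_sub_distrib]
    refine (Finset.abs_sum_le_sum_abs _ _).trans (le_of_eq (Finset.sum_congr rfl fun gh _ => ?_))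
    rw [← mul_sub, abs_mul, abs_of_nonneg (hμ.1 gh)]
  calc (Q bitI + Q bitF) * (1 - |P bitR0 - P bitR1|)
      = ∑ gh, μ gh * ((single P gh bitI + single P gh bitF) * (1 - |P bitR0 - P bitR1|)) := by
        rw [hG, hG, ← Finset.sum_add_distrib, Finset.sum_mul]
        exact Finset.sum_congr rfl fun gh _ => by ring
    _ ≤ ∑ gh, μ gh * ((P bitI + P bitF) * (1 - |single P gh bitR0 - single P gh bitR1|)) :=
        Finset.sum_le_sum fun gh _ => mul_le_mul_of_nonneg_left (single_bound P hP gh) (hμ.1 gh)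
    _ = (P bitI + P bitF) * (1 - ∑ gh, μ gh * |single P gh bitR0 - single P gh bitR1|) := by
        rw [← hμ.2, ← Finset.sum_sub_distrib, Finset.mul_sum]
        exact Finset.sum_congr rfl fun gh _ => by rw [hμ.2]; ring
    _ ≤ _ := mul_le_mul_of_nonneg_left (by linarith) hc
end

section
/- Let P be a probability distribution over bit functions with P(I) + P(F) > 0. For y ∈ Bool, define D(y) = ∑_f ∑_x P(f) · (1/2) · [f(x) = y] (the probability of channel output y under a uniform prior over the input x) and N(y) = P(I)·(1/2)·(∑_x [I(x)=y]) + P(F)·(1/2)·(∑_x [F(x)=y]) (the joint probability of output y and the function being causally connected). Then D(y) > 0 for both values of y, and max( N(false)/D(false), N(true)/D(true) ) = (P(I) + P(F)) / (1 − |P(R0) − P(R1)|). In words, the maximum over post-selected output values of the posterior probability that the implemented function was causally connected equals the monotone M_{|γ|,β}(P). -/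
open Finset

/-- `D P y`: the probability of channel output `y` under a uniform prior on the input. -/
noncomputable def outProb (P : (Bool → Bool) → ℝ) (y : Bool) : ℝ :=
  ∑ f : Bool → Bool, ∑ x : Bool, P f * (1/2) * (if f x = y then 1 else 0)

/-- `N P y`: the joint probability of output `y` and the implemented function being
causally connected (`I` or `F`), under a uniform prior on the input. -/
noncomputable def connProb (P : (Bool → Bool) → ℝ) (y : Bool) : ℝ :=
  P bitI * (1/2) * (∑ x : Bool, if bitI x = y then (1:ℝ) else 0)
    + P bitF * (1/2) * (∑ x : Bool, if bitF x = y then (1:ℝ) else 0)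

/-- A sum over the four bit functions, written out. -/
theorem sum_bitfun (G : (Bool → Bool) → ℝ) :
    ∑ f : Bool → Bool, G f = G bitI + G bitF + G bitR0 + G bitR1 := by
  have h : (Finset.univ : Finset (Bool → Bool)) = {bitI, bitF, bitR0, bitR1} := by decide
  have h1 : bitI ∉ ({bitF, bitR0, bitR1} : Finset (Bool → Bool)) := by decide
  have h2 : bitF ∉ ({bitR0, bitR1} : Finset (Bool → Bool)) := by decide
  have h3 : bitR0 ∉ ({bitR1} : Finset (Bool → Bool)) := by decide
  rw [h, Finset.sum_insert h1, Finset.sum_insert h2, Finset.sum_insert h3, Finset.sum_singleton]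
  ring

/-- for a distribution with `P(I)+P(F) > 0`, both output probabilities are
positive and the maximal posterior probability of causal connection, over the two
post-selected output values, equals `M_{|γ|,β}(P) = (P(I)+P(F))/(1−|P(R0)−P(R1)|)`. -/
theorem stmt_7 (P : (Bool → Bool) → ℝ) (hP : IsDist P)
    (hpos : 0 < P bitI + P bitF) :
    (∀ y : Bool, 0 < outProb P y) ∧
    max (connProb P false / outProb P false) (connProb P true / outProb P true)
      = (P bitI + P bitF) / (1 - |P bitR0 - P bitR1|) := by
  obtain ⟨hnn, hsum⟩ := hP
  rw [sum_bitfun] at hsum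
  have h0 := hnn bitR0
  have h1 := hnn bitR1
  have hD0 : outProb P false = (1 + (P bitR0 - P bitR1)) / 2 := by
    unfold outProb
    rw [sum_bitfun]
    simp [bitI, bitF, bitR0, bitR1] at hsum ⊢
    linarith
  have hD1 : outProb P true = (1 - (P bitR0 - P bitR1)) / 2 := by
    unfold outProb
    rw [sum_bitfun]
    simp [bitI, bitF, bitR0, bitR1] at hsum ⊢
    linarith
  have hN : ∀ y, connProb P y = (P bitI + P bitF) / 2 := by
    intro y
    unfold connProb
    cases y <;> simp [bitI, bitF] <;> ring
  have e0 : 0 < 1 + (P bitR0 - P bitR1) := by linarith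
  have e1 : 0 < 1 - (P bitR0 - P bitR1) := by linarith
  refine ⟨?_, ?_⟩
  · intro y
    cases y
    · rw [hD0]; linarith
    · rw [hD1]; linarith
  · rw [hN, hN, hD0, hD1, div_div_div_cancel_right₀ two_ne_zero,
      div_div_div_cancel_right₀ two_ne_zero]
    rcases le_total 0 (P bitR0 - P bitR1) with h | h
    · rw [abs_of_nonneg h]
      apply max_eq_right
      apply div_le_div_of_nonneg_left hpos.le e1
      linarith
    · rw [abs_of_nonpos h, sub_neg_eq_add]
      apply max_eq_left
      apply div_le_div_of_nonneg_left hpos.le e0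
      linarith
end
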